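/- Let (T_l)_{l∈ℤ} ⊂ B(H) and A = (T_{j−k}) a Toeplitz matrix. Then A maps bounded Toeplitz matrices to bounded Toeplitz matrices under left Schur multiplication (i.e., A * B ∈ B(ℓ²(H)) for every Toeplitz B ∈ B(ℓ²(H))) if and only if Φ_A, defined on H-valued trigonometric polynomials by Φ_A(Σ_l x_l e^{−ilt}) = Σ_l T_l(x_l), extends to a bounded operator from C(𝕋, H) to H; moreover the two norms coincide. -/

import Mathlib

noncomputable section

/-- The Hilbert space `ℓ²(H)` of square-summable `H`-valued sequences. -/
abbrev ellTwo (H : Type) [NormedAddCommGroup H] [InnerProductSpace ℂ H] : Type :=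
  lp (fun _ : ℕ => H) 2

variable {H : Type} [NormedAddCommGroup H] [InnerProductSpace ℂ H] [CompleteSpace H]
  [TopologicalSpace.SeparableSpace H]

/-- A bounded operator `A` on `ℓ²(H)` is represented by the matrix `T = (T_{kj})`
(with `T k j ∈ B(H)`) if `(A (x e_j))_k = T_{kj} x` for all `j, k, x`. -/
def Represents (T : ℕ → ℕ → (H →L[ℂ] H))
    (A : ellTwo H →L[ℂ] ellTwo H) : Prop :=
  ∀ (j : ℕ) (x : H) (k : ℕ), A (lp.single 2 j x) k = T k j x

instance : Fact (0 < 2 * Real.pi) := ⟨by positivity⟩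

/-- `C` is a bound for the Toeplitz matrix `A = (T_{j−k})` as a left Schur multiplier on
bounded Toeplitz matrices: for every Toeplitz `B = (S_{j−k}) ∈ B(ℓ²(H))`, the Schur
product `A * B = (T_{j−k} ∘ S_{j−k})` is bounded with norm at most `C ‖B‖`. -/
def IsLeftToepMultBound (T : ℤ → (H →L[ℂ] H)) (C : ℝ) : Prop :=
  ∀ (S : ℤ → (H →L[ℂ] H)) (B : ellTwo H →L[ℂ] ellTwo H),
    Represents (fun k j => S ((j : ℤ) - (k : ℤ))) B →
    ∃ AB : ellTwo H →L[ℂ] ellTwo H,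
      Represents (fun k j => (T ((j : ℤ) - (k : ℤ))).comp (S ((j : ℤ) - (k : ℤ)))) AB ∧
      ‖AB‖ ≤ C * ‖B‖

/-- `C` bounds the operator `Φ_A : C(𝕋, H) → H`, `Σ_l x_l e^{−ilt} ↦ Σ_l T_l(x_l)`. -/
def IsPhiBound (T : ℤ → (H →L[ℂ] H)) (C : ℝ) : Prop :=
  ∃ Φ : C(AddCircle (2 * Real.pi), H) →L[ℂ] H,
    (∀ (l : ℤ) (x : H),
      Φ ((fourier (-l) : C(AddCircle (2 * Real.pi), ℂ)) •
        (ContinuousMap.const (AddCircle (2 * Real.pi)) x)) = T l x) ∧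
    ‖Φ‖ ≤ C

set_option linter.unusedSectionVars false

open MeasureTheory Filter Topology in
theorem integral_fourier_haar (n : ℤ) :
    ∫ t : AddCircle (2 * Real.pi), (fourier n t : ℂ) ∂AddCircle.haarAddCircle
      = if n = 0 then 1 else 0 := by
  have h := congrFun (fourierCoeff_fourier (T := 2 * Real.pi) n) 0
  simp only [fourierCoeff, neg_zero, fourier_zero, one_smul] at h
  rw [h, Pi.single_apply]
  simp [eq_comm]

open MeasureTheory Filter Topology in
theorem cont_integrable {E : Type*} [NormedAddCommGroup E]
    {f : AddCircle (2 * Real.pi) → E} (hf : Continuous f) :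
    Integrable f AddCircle.haarAddCircle :=
  hf.integrable_of_hasCompactSupport (HasCompactSupport.of_compactSpace _)

open MeasureTheory Filter Topology in
theorem parseval_poly {ι : Type*} (s : Finset ι) (m : ι → ℤ) (hm : Function.Injective m)
    (a : ι → H) :
    ∫ t : AddCircle (2 * Real.pi), ‖∑ i ∈ s, (fourier (m i) t : ℂ) • a i‖ ^ 2
      ∂AddCircle.haarAddCircle = ∑ i ∈ s, ‖a i‖ ^ 2 := by
  have key : ∀ t : AddCircle (2 * Real.pi),
      ((‖∑ i ∈ s, (fourier (m i) t : ℂ) • a i‖ ^ 2 : ℝ) : ℂ)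
        = ∑ i ∈ s, ∑ j ∈ s, (fourier (m j - m i) t : ℂ) * inner ℂ (a i) (a j) := by
    intro t
    push_cast
    have := inner_self_eq_norm_sq_to_K (𝕜 := ℂ) (∑ i ∈ s, (fourier (m i) t : ℂ) • a i)
    rw [show ((‖∑ i ∈ s, (fourier (m i) t : ℂ) • a i‖ : ℝ) : ℂ) ^ 2 = _ from this.symm,
      sum_inner]
    refine Finset.sum_congr rfl fun i _ => ?_
    rw [inner_sum]
    refine Finset.sum_congr rfl fun j _ => ?_
    rw [inner_smul_left, inner_smul_right, ← fourier_neg, sub_eq_add_neg, fourier_add]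
    ring
  apply Complex.ofReal_injective
  refine Eq.trans (integral_ofReal (𝕜 := ℂ)).symm ?_
  refine Eq.trans (integral_congr_ae (Filter.Eventually.of_forall key)) ?_
  rw [integral_finsetSum _ (fun i _ => cont_integrable (by fun_prop))]
  push_cast
  refine Finset.sum_congr rfl fun i hi => ?_
  rw [integral_finsetSum _ (fun i _ => cont_integrable (by fun_prop))]
  simp_rw [integral_mul_const, integral_fourier_haar]
  rw [Finset.sum_eq_single i]
  · simp
  · intro j _ hj
    rw [if_neg, zero_mul]
    rw [sub_eq_zero]
    exact fun h => hj (hm h)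
  · exact fun h => absurd hi h

open MeasureTheory in
/-- finite sections of a Toeplitz matrix with polynomial symbol -/
theorem section_bound_of_symbol (L : Finset ℤ) (R : ℤ → (H →L[ℂ] H)) (hR : ∀ l ∉ L, R l = 0)
    (M : ℝ)
    (hg : ∀ (t : AddCircle (2 * Real.pi)) (x : H),
      ‖∑ l ∈ L, (fourier l t : ℂ) • R l x‖ ≤ M * ‖x‖) (n : ℕ) (v : ℕ → H) :
    ∑ k ∈ Finset.range n, ‖∑ j ∈ Finset.range n, R ((j : ℤ) - (k : ℤ)) (v j)‖ ^ 2
      ≤ M ^ 2 * ∑ j ∈ Finset.range n, ‖v j‖ ^ 2 := by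
  classical
  set u : ℤ → H := fun k => ∑ j ∈ Finset.range n, R ((j : ℤ) - k) (v j) with hu
  set K0 : Finset ℤ := (Finset.range n).image (fun k : ℕ => (k : ℤ)) with hK0
  set K : Finset ℤ := K0 ∪ (Finset.range n ×ˢ L).image (fun p => (p.1 : ℤ) - p.2) with hK
  have h1 := parseval_poly (Finset.range n) (fun j : ℕ => -(j : ℤ))
    (fun a b h => by simpa using h) v
  have h2 := parseval_poly K (fun k : ℤ => -k) neg_injective u
  have hid : ∀ t : AddCircle (2 * Real.pi), ∑ k ∈ K, (fourier (-k) t : ℂ) • u k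
      = ∑ l ∈ L, (fourier l t : ℂ) • R l
        (∑ j ∈ Finset.range n, (fourier (-(j : ℤ)) t : ℂ) • v j) := by
    intro t
    simp only [hu, map_sum, Finset.smul_sum, map_smul]
    rw [Finset.sum_comm, Finset.sum_comm (s := L)]
    refine Finset.sum_congr rfl fun j hj => ?_
    symm
    refine Finset.sum_of_injOn (fun l => (j : ℤ) - l) ?_ ?_ ?_ ?_
    · intro a _ b _ h
      simpa using h
    · intro l hl
      simp only [hK, Finset.coe_union, Set.mem_union, Finset.mem_coe, Finset.mem_image]
      exact Or.inr ⟨(j, l), Finset.mem_product.2 ⟨hj, hl⟩, rfl⟩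
    · intro k _ hk
      rw [hR, zero_apply, smul_zero]
      intro hl
      exact hk ⟨(j : ℤ) - k, hl, by simp⟩
    · intro l _
      simp only [sub_sub_cancel]
      rw [smul_smul, ← fourier_add]
      congr 3
      ring
  calc ∑ k ∈ Finset.range n, ‖∑ j ∈ Finset.range n, R ((j : ℤ) - (k : ℤ)) (v j)‖ ^ 2
      = ∑ k ∈ K0, ‖u k‖ ^ 2 := by
        rw [hK0, Finset.sum_image (fun a _ b _ h => by simpa using h)]
    _ ≤ ∑ k ∈ K, ‖u k‖ ^ 2 :=
        Finset.sum_le_sum_of_subset_of_nonneg Finset.subset_union_left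
          (fun _ _ _ => by positivity)
    _ ≤ M ^ 2 * ∑ j ∈ Finset.range n, ‖v j‖ ^ 2 := by
        rw [← h1, ← h2, ← integral_const_mul]
        refine integral_mono (cont_integrable (by fun_prop)) (cont_integrable (by fun_prop)) ?_
        intro t
        simp only [hid t]
        rw [← mul_pow]
        exact pow_le_pow_left₀ (norm_nonneg _) (hg t _) 2

/-- number of index pairs on the `l`-th diagonal -/
def diagCount (N : ℕ) (l : ℤ) : ℕ :=
  ((Finset.range N ×ˢ Finset.range N).filter (fun p => (p.1 : ℤ) - (p.2 : ℤ) = l)).card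

theorem diagCount_le (N : ℕ) (l : ℤ) : diagCount N l ≤ N := by
  unfold diagCount
  conv_rhs => rw [← Finset.card_range N]
  refine Finset.card_le_card_of_injOn (fun p => p.1) ?_ ?_
  · intro p hp
    simp at hp ⊢
    omega
  · rintro ⟨a, b⟩ hp ⟨c, d⟩ hq h
    simp at hp hq h
    ext <;> simp <;> omega

theorem le_diagCount (N : ℕ) (l : ℤ) : N ≤ diagCount N l + l.natAbs := by
  unfold diagCount
  rw [← Nat.sub_le_iff_le_add]
  conv_lhs => rw [← Finset.card_range (N - l.natAbs)]
  refine Finset.card_le_card_of_injOn (fun k => (k + l.toNat, k + (-l).toNat)) ?_ ?_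
  · intro p hp
    simp at hp ⊢
    omega
  · intro a _ b _ h
    simp at h
    exact h

open Filter Topology in
theorem tendsto_diagCount (l : ℤ) :
    Tendsto (fun N : ℕ => ((N : ℂ)⁻¹ * (diagCount N l : ℂ))) atTop (𝓝 1) := by
  have hr : Tendsto (fun N : ℕ => ((N : ℝ)⁻¹ * (diagCount N l : ℝ))) atTop (𝓝 1) := by
    have h0 : Tendsto (fun N : ℕ => 1 - (l.natAbs : ℝ) / (N : ℝ)) atTop (𝓝 1) := by
      simpa using (tendsto_const_div_atTop_nhds_zero_nat (l.natAbs : ℝ)).const_sub 1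
    refine tendsto_of_tendsto_of_tendsto_of_le_of_le' h0 tendsto_const_nhds ?_ ?_
    · filter_upwards [eventually_gt_atTop 0] with N hN
      have hN' : (0 : ℝ) < N := by exact_mod_cast hN
      have := le_diagCount N l
      have h' : (N : ℝ) ≤ diagCount N l + l.natAbs := by exact_mod_cast this
      rw [inv_mul_eq_div, sub_le_iff_le_add, ← add_div, le_div_iff₀ hN']
      linarith
    · filter_upwards [eventually_gt_atTop 0] with N hN
      have hN' : (0 : ℝ) < N := by exact_mod_cast hN
      have h' : (diagCount N l : ℝ) ≤ N := by exact_mod_cast diagCount_le N l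
      rw [inv_mul_eq_div, div_le_one hN']
      exact h'
  have := (Complex.continuous_ofReal.tendsto 1).comp hr
  simpa [Function.comp_def] using this

theorem double_sum_diag {E : Type*} [AddCommGroup E] [Module ℂ E] (N : ℕ) (L : Finset ℤ)
    (F : ℤ → E)
    (hF : ∀ j < N, ∀ k < N, ((j : ℤ) - (k : ℤ)) ∈ L ∨ F ((j : ℤ) - (k : ℤ)) = 0) :
    ∑ j ∈ Finset.range N, ∑ k ∈ Finset.range N, F ((j : ℤ) - (k : ℤ))
      = ∑ l ∈ L, (diagCount N l : ℂ) • F l := by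
  classical
  rw [← Finset.sum_product' (f := fun j k : ℕ => F ((j : ℤ) - (k : ℤ)))]
  have h : ∀ p ∈ Finset.range N ×ˢ Finset.range N, F ((p.1 : ℤ) - (p.2 : ℤ))
      = ∑ l ∈ L, if (p.1 : ℤ) - (p.2 : ℤ) = l then F l else 0 := by
    intro p hp
    rw [Finset.sum_ite_eq]
    simp only [Finset.mem_product, Finset.mem_range] at hp
    rcases hF p.1 hp.1 p.2 hp.2 with h | h
    · rw [if_pos h]
    · rw [h]; simp
  rw [Finset.sum_congr rfl h, Finset.sum_comm]
  refine Finset.sum_congr rfl fun l _ => ?_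
  rw [← Finset.sum_filter, Finset.sum_const, diagCount, Nat.cast_smul_eq_nsmul]

open Filter Topology in
theorem section_bound_of_cesaro (R : ℤ → (H →L[ℂ] H)) (M : ℝ)
    (hG : ∀ (N : ℕ) (t : AddCircle (2 * Real.pi)) (x : H),
      ‖(N : ℂ)⁻¹ • ∑ j ∈ Finset.range N, ∑ k ∈ Finset.range N,
        (fourier ((j : ℤ) - (k : ℤ)) t : ℂ) • R ((j : ℤ) - (k : ℤ)) x‖ ≤ M * ‖x‖)
    (n : ℕ) (v : ℕ → H) :
    ∑ k ∈ Finset.range n, ‖∑ j ∈ Finset.range n, R ((j : ℤ) - (k : ℤ)) (v j)‖ ^ 2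
      ≤ M ^ 2 * ∑ j ∈ Finset.range n, ‖v j‖ ^ 2 := by
  have hN : ∀ N : ℕ,
      ∑ k ∈ Finset.range n, ‖∑ j ∈ Finset.range n,
        ((N : ℂ)⁻¹ * (diagCount N ((j : ℤ) - (k : ℤ)) : ℂ)) • R ((j : ℤ) - (k : ℤ)) (v j)‖ ^ 2
      ≤ M ^ 2 * ∑ j ∈ Finset.range n, ‖v j‖ ^ 2 := by
    intro N
    refine section_bound_of_symbol (Finset.Icc (-(N : ℤ)) N)
      (fun l => ((N : ℂ)⁻¹ * (diagCount N l : ℂ)) • R l) ?_ M ?_ n v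
    · intro l hl
      have : diagCount N l = 0 := by
        unfold diagCount
        rw [Finset.card_eq_zero, Finset.filter_eq_empty_iff]
        intro p hp h
        simp at hp hl
        omega
      simp [this]
    · intro t x
      refine le_trans (le_of_eq ?_) (hG N t x)
      rw [double_sum_diag N (Finset.Icc (-(N : ℤ)) N)
        (fun l => (fourier l t : ℂ) • R l x), Finset.smul_sum]
      · congr 1
        refine Finset.sum_congr rfl fun l _ => ?_
        simp only [smul_apply, smul_smul]
        congr 1
        ring
      · intro j hj k hk
        left
        simp
        omega
  refine le_of_tendsto' (f := fun N : ℕ => _) (x := atTop) ?_ hN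
  refine tendsto_finsetSum _ fun k _ => ?_
  refine Tendsto.pow (Tendsto.norm ?_) 2
  refine tendsto_finsetSum _ fun j _ => ?_
  simpa using (tendsto_diagCount ((j : ℤ) - (k : ℤ))).smul_const (R ((j : ℤ) - (k : ℤ)) (v j))

/-- Construct an operator from uniformly bounded finite sections. -/
theorem exists_op_of_section_bound (R : ℤ → (H →L[ℂ] H)) (M : ℝ) (hM : 0 ≤ M)
    (hb : ∀ (n : ℕ) (v : ℕ → H),
      ∑ k ∈ Finset.range n, ‖∑ j ∈ Finset.range n, R ((j : ℤ) - (k : ℤ)) (v j)‖ ^ 2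
      ≤ M ^ 2 * ∑ j ∈ Finset.range n, ‖v j‖ ^ 2) :
    ∃ A : ellTwo H →L[ℂ] ellTwo H,
      Represents (fun k j => R ((j : ℤ) - (k : ℤ))) A ∧ ‖A‖ ≤ M := by
  classical
  have hb' : ∀ (v : ℕ →₀ H) (s : Finset ℕ),
      ∑ k ∈ s, ‖v.sum (fun j x => R ((j : ℤ) - (k : ℤ)) x)‖ ^ 2
        ≤ M ^ 2 * ∑ j ∈ v.support, ‖v j‖ ^ 2 := by
    intro v s
    obtain ⟨n, hn⟩ := (s ∪ v.support).exists_nat_subset_range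
    have hs : s ⊆ Finset.range n := Finset.subset_union_left.trans hn
    have hv : v.support ⊆ Finset.range n := Finset.subset_union_right.trans hn
    have h1 : ∑ j ∈ v.support, ‖v j‖ ^ 2 = ∑ j ∈ Finset.range n, ‖v j‖ ^ 2 := by
      refine Finset.sum_subset hv fun j _ hj => ?_
      rw [Finsupp.notMem_support_iff.1 hj]; simp
    have h2 : ∀ k : ℕ, v.sum (fun j x => R ((j : ℤ) - (k : ℤ)) x)
        = ∑ j ∈ Finset.range n, R ((j : ℤ) - (k : ℤ)) (v j) := by
      intro k
      exact Finsupp.sum_of_support_subset v hv _ (by simp)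
    rw [h1]
    refine le_trans ?_ (hb n v)
    simp_rw [h2]
    exact Finset.sum_le_sum_of_subset_of_nonneg hs (fun _ _ _ => by positivity)
  have hmem : ∀ v : ℕ →₀ H,
      Memℓp (fun k : ℕ => v.sum (fun j x => R ((j : ℤ) - (k : ℤ)) x)) 2 := by
    intro v
    refine memℓp_gen' (C := M ^ 2 * ∑ j ∈ v.support, ‖v j‖ ^ 2) fun s => ?_
    simpa using hb' v s
  let f : (ℕ →₀ H) →ₗ[ℂ] ellTwo H :=
    { toFun := fun v => ⟨_, hmem v⟩
      map_add' := by
        intro v w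
        ext k
        exact Finsupp.sum_add_index' (by simp) (by simp)
      map_smul' := by
        intro c v
        ext k
        simp only [lp.coeFn_smul, Pi.smul_apply, RingHom.id_apply]
        rw [Finsupp.sum_smul_index' (by simp), Finsupp.smul_sum]
        simp }
  have hf : ∀ v k, f v k = v.sum (fun j x => R ((j : ℤ) - (k : ℤ)) x) := fun _ _ => rfl
  let e : (ℕ →₀ H) →ₗ[ℂ] ellTwo H :=
    Finsupp.lsum ℂ (fun j => lp.lsingle (𝕜 := ℂ) (E := fun _ : ℕ => H) 2 j)
  have he : ∀ v : ℕ →₀ H, e v = ∑ j ∈ v.support, lp.single 2 j (v j) := fun v => rfl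
  have hes : ∀ j x, e (Finsupp.single j x) = lp.single 2 j x := by
    intro j x
    simp [e]
  have hnorm : ∀ v, ‖f v‖ ≤ M * ‖e v‖ := by
    intro v
    refine lp.norm_le_of_forall_sum_le (by norm_num) (by positivity) fun s => ?_
    have h3 := lp.norm_sum_single (E := fun _ : ℕ => H) (p := 2) (by norm_num) v v.support
    rw [← he] at h3
    rw [Real.mul_rpow hM (norm_nonneg _), h3]
    simpa [hf] using hb' v s
  have hd : DenseRange e := by
    intro x
    have hx := lp.hasSum_single (E := fun _ : ℕ => H) (p := 2) (by norm_num) x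
    refine mem_closure_of_tendsto hx (Filter.Eventually.of_forall fun s => ?_)
    refine ⟨∑ i ∈ s, Finsupp.single i (x i), ?_⟩
    simp [map_sum, hes]
  refine ⟨f.extendOfNorm e, ?_, LinearMap.opNorm_extendOfNorm_le hd hM hnorm⟩
  intro j x k
  rw [← hes, LinearMap.extendOfNorm_eq hd ⟨M, hnorm⟩, hf]
  simp

theorem fourier_norm_apply (n : ℤ) (t : AddCircle (2 * Real.pi)) : ‖(fourier n t : ℂ)‖ = 1 := by
  rw [fourier_apply]; exact Circle.norm_coe _

/-- Cesaro means of the symbol are bounded by the operator norm -/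
theorem cesaro_bound (S : ℤ → (H →L[ℂ] H)) (B : ellTwo H →L[ℂ] ellTwo H)
    (hB : Represents (fun k j => S ((j : ℤ) - (k : ℤ))) B) (N : ℕ)
    (t : AddCircle (2 * Real.pi)) (x : H) :
    ‖(N : ℂ)⁻¹ • ∑ j ∈ Finset.range N, ∑ k ∈ Finset.range N,
        (fourier ((j : ℤ) - (k : ℤ)) t : ℂ) • S ((j : ℤ) - (k : ℤ)) x‖ ≤ ‖B‖ * ‖x‖ := by
  rcases Nat.eq_zero_or_pos N with rfl | hN
  · simp; positivity
  have hN' : (0 : ℝ) < N := by exact_mod_cast hN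
  set v : ellTwo H := ∑ j ∈ Finset.range N, lp.single 2 j ((fourier (j : ℤ) t : ℂ) • x) with hv
  have hvn : ‖v‖ ^ 2 = N * ‖x‖ ^ 2 := by
    have h3 := lp.norm_sum_single (E := fun _ : ℕ => H) (p := 2) (by norm_num)
      (fun j : ℕ => (fourier (j : ℤ) t : ℂ) • x) (Finset.range N)
    simp only [ENNReal.toReal_ofNat, Real.rpow_ofNat, norm_smul, fourier_norm_apply, one_mul,
      Finset.sum_const, Finset.card_range, nsmul_eq_mul] at h3
    exact h3
  have hBv : ∀ k : ℕ, B v k = ∑ j ∈ Finset.range N,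
      (fourier (j : ℤ) t : ℂ) • S ((j : ℤ) - (k : ℤ)) x := by
    intro k
    rw [hv, map_sum, lp.coeFn_sum, Finset.sum_apply]
    refine Finset.sum_congr rfl fun j _ => ?_
    rw [hB j _ k, map_smul]
  have hsum : ∑ j ∈ Finset.range N, ∑ k ∈ Finset.range N,
        (fourier ((j : ℤ) - (k : ℤ)) t : ℂ) • S ((j : ℤ) - (k : ℤ)) x
      = ∑ k ∈ Finset.range N, (fourier (-(k : ℤ)) t : ℂ) • B v k := by
    rw [Finset.sum_comm]
    refine Finset.sum_congr rfl fun k _ => ?_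
    rw [hBv, Finset.smul_sum]
    refine Finset.sum_congr rfl fun j _ => ?_
    rw [smul_smul, ← fourier_add]
    congr 3
    ring
  have h4 : ∑ k ∈ Finset.range N, ‖B v k‖ ^ 2 ≤ ‖B v‖ ^ 2 := by
    simpa using lp.sum_rpow_le_norm_rpow (E := fun _ : ℕ => H) (p := 2) (by norm_num) (B v)
      (Finset.range N)
  have h5 : ‖∑ k ∈ Finset.range N, (fourier (-(k : ℤ)) t : ℂ) • B v k‖
      ≤ ∑ k ∈ Finset.range N, ‖B v k‖ := by
    refine (norm_sum_le _ _).trans (le_of_eq (Finset.sum_congr rfl fun k _ => ?_))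
    rw [norm_smul, fourier_norm_apply, one_mul]
  have h6 : (∑ k ∈ Finset.range N, ‖B v k‖) ^ 2 ≤ N * ∑ k ∈ Finset.range N, ‖B v k‖ ^ 2 := by
    simpa using sq_sum_le_card_mul_sum_sq (s := Finset.range N) (f := fun k => ‖B v k‖)
  have h7 : ‖B v‖ ^ 2 ≤ ‖B‖ ^ 2 * (N * ‖x‖ ^ 2) := by
    rw [← hvn, ← mul_pow]
    exact pow_le_pow_left₀ (norm_nonneg _) (B.le_opNorm v) 2
  have h8 : ∑ k ∈ Finset.range N, ‖B v k‖ ≤ N * (‖B‖ * ‖x‖) := by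
    refine le_of_sq_le_sq ?_ (by positivity)
    calc _ ≤ N * ∑ k ∈ Finset.range N, ‖B v k‖ ^ 2 := h6
      _ ≤ N * (‖B‖ ^ 2 * (N * ‖x‖ ^ 2)) := by gcongr; exact h4.trans h7
      _ = _ := by ring
  rw [hsum, norm_smul, norm_inv, Complex.norm_natCast, inv_mul_le_iff₀ hN']
  exact h5.trans h8

/-- vector-valued trigonometric polynomials -/
def trigPoly (H : Type) [NormedAddCommGroup H] [InnerProductSpace ℂ H] :
    (ℤ →₀ H) →ₗ[ℂ] C(AddCircle (2 * Real.pi), H) :=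
  Finsupp.lsum ℂ (fun l : ℤ =>
    { toFun := fun x => (fourier (-l) : C(AddCircle (2 * Real.pi), ℂ)) •
        (ContinuousMap.const (AddCircle (2 * Real.pi)) x)
      map_add' := by intro x y; ext t; simp
      map_smul' := by intro c x; ext t; exact smul_comm _ _ _ })

theorem trigPoly_single (l : ℤ) (x : H) :
    trigPoly H (Finsupp.single l x) = (fourier (-l) : C(AddCircle (2 * Real.pi), ℂ)) •
        (ContinuousMap.const (AddCircle (2 * Real.pi)) x) := by
  simp [trigPoly]

theorem trigPoly_apply (v : ℤ →₀ H) (t : AddCircle (2 * Real.pi)) :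
    trigPoly H v t = ∑ l ∈ v.support, (fourier (-l) t : ℂ) • v l := by
  simp [trigPoly, Finsupp.sum, ContinuousMap.sum_apply]

theorem trigPoly_dense : DenseRange (trigPoly H) := by
  classical
  set P : Submodule ℂ C(AddCircle (2 * Real.pi), H) :=
    (LinearMap.range (trigPoly H)).topologicalClosure with hP
  have hsc : ∀ (φ : C(AddCircle (2 * Real.pi), ℂ)) (x : H),
      φ • ContinuousMap.const (AddCircle (2 * Real.pi)) x ∈ P := by
    intro φ x
    let Lx : C(AddCircle (2 * Real.pi), ℂ) →L[ℂ] C(AddCircle (2 * Real.pi), H) :=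
      LinearMap.mkContinuous
        { toFun := fun φ => φ • ContinuousMap.const (AddCircle (2 * Real.pi)) x
          map_add' := by intro a b; ext t; simp [add_smul]
          map_smul' := by intro c a; ext t; simp [mul_smul] } ‖x‖ (by
            intro φ
            refine (ContinuousMap.norm_le _ (by positivity)).2 fun t => ?_
            simp only [LinearMap.coe_mk, AddHom.coe_mk, ContinuousMap.smul_apply',
              ContinuousMap.const_apply, norm_smul]
            rw [mul_comm]
            gcongr
            exact φ.norm_coe_le_norm t)
    have hle : (Submodule.span ℂ (Set.range (@fourier (2 * Real.pi)))).topologicalClosure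
        ≤ P.comap Lx.toLinearMap := by
      refine Submodule.topologicalClosure_minimal _ ?_ ?_
      · rw [Submodule.span_le]
        rintro _ ⟨n, rfl⟩
        refine (Submodule.le_topologicalClosure _) ⟨Finsupp.single (-n) x, ?_⟩
        rw [trigPoly_single, neg_neg]
        rfl
      · exact (Submodule.isClosed_topologicalClosure _).preimage Lx.continuous
    rw [span_fourier_closure_eq_top] at hle
    exact hle (Submodule.mem_top (x := φ))
  suffices h : ∀ f : C(AddCircle (2 * Real.pi), H), f ∈ P by
    intro f
    exact h f
  intro f
  have hPc : IsClosed (P : Set C(AddCircle (2 * Real.pi), H)) :=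
    Submodule.isClosed_topologicalClosure _
  rw [← SetLike.mem_coe, ← hPc.closure_eq, Metric.mem_closure_iff]
  intro ε hε
  obtain ⟨s, hs⟩ := isCompact_univ.elim_nhds_subcover
    (fun a : AddCircle (2 * Real.pi) => f ⁻¹' Metric.ball (f a) (ε / 2))
    (fun a _ => f.continuous.continuousAt.preimage_mem_nhds (Metric.ball_mem_nhds _ (by positivity)))
  obtain ⟨ρ, hρ⟩ := PartitionOfUnity.exists_isSubordinate (X := AddCircle (2 * Real.pi))
    (s := Set.univ) isClosed_univ (fun a : s => f ⁻¹' Metric.ball (f a) (ε / 2))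
    (fun a => Metric.isOpen_ball.preimage f.continuous) (by
      intro t ht
      obtain ⟨a, ha, h⟩ := Set.mem_iUnion₂.1 (hs.2 ht)
      exact Set.mem_iUnion.2 ⟨⟨a, ha⟩, h⟩)
  let φ : s → C(AddCircle (2 * Real.pi), ℂ) := fun i =>
    ⟨fun t => ((ρ i t : ℝ) : ℂ), by fun_prop⟩
  refine ⟨∑ i : s, φ i • ContinuousMap.const (AddCircle (2 * Real.pi)) (f i),
    P.sum_mem fun i _ => hsc _ _, ?_⟩
  refine lt_of_le_of_lt ((ContinuousMap.dist_le (by positivity : 0 ≤ ε / 2)).2 fun t => ?_)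
    (half_lt_self hε)
  have h1 : ∑ i : s, ρ i t = 1 := by
    have := ρ.sum_eq_one (Set.mem_univ t)
    rwa [finsum_eq_sum_of_fintype] at this
  have h2 : f t - (∑ i : s, φ i • ContinuousMap.const (AddCircle (2 * Real.pi)) (f i)) t
      = ∑ i : s, ((ρ i t : ℝ) : ℂ) • (f t - f i) := by
    simp only [smul_sub, Finset.sum_sub_distrib, ← Finset.sum_smul, ← Complex.ofReal_sum, h1]
    simp [ContinuousMap.sum_apply, φ]
  rw [dist_eq_norm, h2]
  calc _ ≤ ∑ i : s, ‖((ρ i t : ℝ) : ℂ) • (f t - f i)‖ := norm_sum_le _ _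
    _ ≤ ∑ i : s, ρ i t * (ε / 2) := by
      refine Finset.sum_le_sum fun i _ => ?_
      rw [norm_smul, Complex.norm_real, Real.norm_of_nonneg (ρ.nonneg i t)]
      by_cases h0 : ρ i t = 0
      · simp [h0]
      · refine mul_le_mul_of_nonneg_left ?_ (ρ.nonneg i t)
        have : t ∈ f ⁻¹' Metric.ball (f i) (ε / 2) := hρ i (subset_tsupport _ h0)
        rw [← dist_eq_norm]
        exact (Metric.mem_ball.1 this).le
    _ = ε / 2 := by rw [← Finset.sum_mul, h1, one_mul]

/-- the shifted Cesaro polynomial -/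
def shiftPoly (S : ℤ → (H →L[ℂ] H)) (N : ℕ) (t : AddCircle (2 * Real.pi)) (x : H) :
    C(AddCircle (2 * Real.pi), H) :=
  (N : ℂ)⁻¹ • ∑ j ∈ Finset.range N, ∑ k ∈ Finset.range N,
      ((fourier (-((j : ℤ) - (k : ℤ))) : C(AddCircle (2 * Real.pi), ℂ)) •
        (ContinuousMap.const (AddCircle (2 * Real.pi))
          ((fourier ((j : ℤ) - (k : ℤ)) t : ℂ) • S ((j : ℤ) - (k : ℤ)) x)))

theorem phi_shiftPoly (T S : ℤ → (H →L[ℂ] H)) (Φ : C(AddCircle (2 * Real.pi), H) →L[ℂ] H)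
    (hΦ : ∀ (l : ℤ) (x : H),
      Φ ((fourier (-l) : C(AddCircle (2 * Real.pi), ℂ)) •
        (ContinuousMap.const (AddCircle (2 * Real.pi)) x)) = T l x)
    (N : ℕ) (t : AddCircle (2 * Real.pi)) (x : H) :
    (N : ℂ)⁻¹ • ∑ j ∈ Finset.range N, ∑ k ∈ Finset.range N,
        (fourier ((j : ℤ) - (k : ℤ)) t : ℂ) •
          ((T ((j : ℤ) - (k : ℤ))).comp (S ((j : ℤ) - (k : ℤ)))) x = Φ (shiftPoly S N t x) := by
  unfold shiftPoly
  rw [map_smul, map_sum]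
  congr 1
  refine Finset.sum_congr rfl fun j _ => ?_
  rw [map_sum]
  refine Finset.sum_congr rfl fun k _ => ?_
  rw [hΦ, map_smul, ContinuousLinearMap.comp_apply]

theorem shiftPoly_apply (S : ℤ → (H →L[ℂ] H)) (N : ℕ) (t s : AddCircle (2 * Real.pi)) (x : H) :
    shiftPoly S N t x s = (N : ℂ)⁻¹ • ∑ j ∈ Finset.range N, ∑ k ∈ Finset.range N,
        (fourier ((j : ℤ) - (k : ℤ)) (t - s) : ℂ) • S ((j : ℤ) - (k : ℤ)) x := by
  unfold shiftPoly
  simp only [ContinuousMap.smul_apply, ContinuousMap.sum_apply, ContinuousMap.smul_apply',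
      ContinuousMap.const_apply, smul_smul]
  congr 1
  refine Finset.sum_congr rfl fun j _ => Finset.sum_congr rfl fun k _ => ?_
  congr 1
  rw [fourier_apply, fourier_apply, fourier_apply, ← Circle.coe_mul, ← AddCircle.toCircle_add]
  congr 2
  rw [smul_sub, neg_smul]
  abel

theorem exists_op_of_cesaro (R : ℤ → (H →L[ℂ] H)) (M : ℝ) (hM : 0 ≤ M)
    (hG : ∀ (N : ℕ) (t : AddCircle (2 * Real.pi)) (x : H),
      ‖(N : ℂ)⁻¹ • ∑ j ∈ Finset.range N, ∑ k ∈ Finset.range N,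
        (fourier ((j : ℤ) - (k : ℤ)) t : ℂ) • R ((j : ℤ) - (k : ℤ)) x‖ ≤ M * ‖x‖) :
    ∃ A : ellTwo H →L[ℂ] ellTwo H,
      Represents (fun k j => R ((j : ℤ) - (k : ℤ))) A ∧ ‖A‖ ≤ M := by
  have h := section_bound_of_cesaro R M hG
  exact exists_op_of_section_bound R M hM h

theorem exists_op_of_symbol (L : Finset ℤ) (R : ℤ → (H →L[ℂ] H)) (hR : ∀ l ∉ L, R l = 0)
    (M : ℝ) (hM : 0 ≤ M)
    (hg : ∀ (t : AddCircle (2 * Real.pi)) (x : H),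
      ‖∑ l ∈ L, (fourier l t : ℂ) • R l x‖ ≤ M * ‖x‖) :
    ∃ A : ellTwo H →L[ℂ] ellTwo H,
      Represents (fun k j => R ((j : ℤ) - (k : ℤ))) A ∧ ‖A‖ ≤ M := by
  have h := section_bound_of_symbol L R hR M hg
  exact exists_op_of_section_bound R M hM h

theorem mult_of_phi (T : ℤ → (H →L[ℂ] H)) (C : ℝ) (hC : 0 ≤ C) (h : IsPhiBound T C) :
    IsLeftToepMultBound T C := by
  obtain ⟨Φ, hΦ, hn⟩ := h
  intro S B hB
  refine exists_op_of_cesaro (fun l => (T l).comp (S l)) (C * ‖B‖) (by positivity) ?_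
  intro N t x
  have h2 : ‖shiftPoly S N t x‖ ≤ ‖B‖ * ‖x‖ := by
    refine (ContinuousMap.norm_le _ (by positivity)).2 fun s => ?_
    rw [shiftPoly_apply]
    exact cesaro_bound S B hB N (t - s) x
  rw [phi_shiftPoly T S Φ hΦ]
  calc ‖Φ (shiftPoly S N t x)‖ ≤ ‖Φ‖ * ‖shiftPoly S N t x‖ := Φ.le_opNorm _
    _ ≤ C * (‖B‖ * ‖x‖) := by gcongr
    _ = _ := by ring

open Filter Topology in
theorem norm_symbol_le (R : ℤ → (H →L[ℂ] H)) (A : ellTwo H →L[ℂ] ellTwo H)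
    (hA : Represents (fun k j => R ((j : ℤ) - (k : ℤ))) A) (L : Finset ℤ) (x : H)
    (hL : ∀ l ∉ L, R l x = 0) : ‖∑ l ∈ L, R l x‖ ≤ ‖A‖ * ‖x‖ := by
  have hN := fun N : ℕ => cesaro_bound R A hA N 0 x
  refine le_of_tendsto' (x := atTop) ?_ hN
  refine Tendsto.norm ?_
  have heq : ∀ N : ℕ, (N : ℂ)⁻¹ • ∑ j ∈ Finset.range N, ∑ k ∈ Finset.range N,
      (fourier ((j : ℤ) - (k : ℤ)) (0 : AddCircle (2 * Real.pi)) : ℂ) • R ((j : ℤ) - (k : ℤ)) x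
      = ∑ l ∈ L, ((N : ℂ)⁻¹ * (diagCount N l : ℂ)) • R l x := by
    intro N
    simp only [fourier_eval_zero, one_smul]
    rw [double_sum_diag N L (fun l => R l x), Finset.smul_sum]
    · simp only [smul_smul]
    · intro j _ k _
      by_cases hm : ((j : ℤ) - (k : ℤ)) ∈ L
      · exact Or.inl hm
      · exact Or.inr (hL _ hm)
  simp_rw [heq]
  refine tendsto_finsetSum _ fun l _ => ?_
  simpa using (tendsto_diagCount l).smul_const (R l x)

/-- rank one coefficients -/
def rankOneCoeff (e : H) (v : ℤ →₀ H) (l : ℤ) : H →L[ℂ] H := (innerSL ℂ e).smulRight (v l)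

theorem rankOneCoeff_apply (e : H) (v : ℤ →₀ H) (l : ℤ) (y : H) :
    rankOneCoeff e v l y = inner ℂ e y • v l := rfl

theorem rankOneCoeff_self (e : H) (he : ‖e‖ = 1) (v : ℤ →₀ H) (l : ℤ) :
    rankOneCoeff e v l e = v l := by
  rw [rankOneCoeff_apply, inner_self_eq_norm_sq_to_K, he]
  simp

theorem rankOneCoeff_zero (e : H) (v : ℤ →₀ H) (l : ℤ) (hl : l ∉ v.support) :
    rankOneCoeff e v l = 0 := by
  ext y
  rw [rankOneCoeff_apply, Finsupp.notMem_support_iff.1 hl]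
  simp

theorem exists_rankOne_op (e : H) (he : ‖e‖ = 1) (v : ℤ →₀ H) :
    ∃ B : ellTwo H →L[ℂ] ellTwo H,
      Represents (fun k j => rankOneCoeff e v ((j : ℤ) - (k : ℤ))) B ∧ ‖B‖ ≤ ‖trigPoly H v‖ := by
  refine exists_op_of_symbol v.support (rankOneCoeff e v) (rankOneCoeff_zero e v) ‖trigPoly H v‖
    (norm_nonneg _) ?_
  intro t y
  have h1 : ∑ l ∈ v.support, (fourier l t : ℂ) • rankOneCoeff e v l y
      = inner ℂ e y • trigPoly H v (-t) := by
    rw [trigPoly_apply, Finset.smul_sum]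
    refine Finset.sum_congr rfl fun l _ => ?_
    rw [rankOneCoeff_apply, smul_comm]
    congr 2
    rw [fourier_apply, fourier_apply]
    simp
  rw [h1, norm_smul, mul_comm]
  gcongr
  · exact ContinuousMap.norm_coe_le_norm _ _
  · simpa [he] using norm_inner_le_norm (𝕜 := ℂ) e y

theorem norm_le_of_mult (T : ℤ → (H →L[ℂ] H)) (C : ℝ) (hC : 0 ≤ C)
    (h : IsLeftToepMultBound T C) (v : ℤ →₀ H) :
    ‖∑ l ∈ v.support, T l (v l)‖ ≤ C * ‖trigPoly H v‖ := by
  rcases subsingleton_or_nontrivial H with hs | hs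
  · rw [Subsingleton.elim (∑ l ∈ v.support, T l (v l)) 0, norm_zero]
    exact mul_nonneg hC (norm_nonneg _)
  obtain ⟨e, he⟩ := exists_norm_eq H (zero_le_one (α := ℝ))
  obtain ⟨B, hB, hBn⟩ := exists_rankOne_op e he v
  obtain ⟨AB, hAB, hABn⟩ := h _ B hB
  have hle := norm_symbol_le (fun l => (T l).comp (rankOneCoeff e v l)) AB hAB v.support e (by
    intro l hl
    rw [rankOneCoeff_zero e v l hl]
    simp)
  simp only [ContinuousLinearMap.comp_apply, rankOneCoeff_self e he, he, mul_one] at hle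
  calc _ ≤ ‖AB‖ := hle
    _ ≤ C * ‖B‖ := hABn
    _ ≤ C * ‖trigPoly H v‖ := mul_le_mul_of_nonneg_left hBn hC

/-- `Φ` on trigonometric polynomials -/
def phiPoly (T : ℤ → (H →L[ℂ] H)) : (ℤ →₀ H) →ₗ[ℂ] H :=
  Finsupp.lsum ℂ (fun l => (T l).toLinearMap)

theorem phiPoly_single (T : ℤ → (H →L[ℂ] H)) (l : ℤ) (x : H) :
    phiPoly T (Finsupp.single l x) = T l x := by
  simp [phiPoly]

theorem phiPoly_norm (T : ℤ → (H →L[ℂ] H)) (C : ℝ) (hC : 0 ≤ C)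
    (h : IsLeftToepMultBound T C) (v : ℤ →₀ H) : ‖phiPoly T v‖ ≤ C * ‖trigPoly H v‖ :=
  norm_le_of_mult T C hC h v

theorem phiPoly_extend (T : ℤ → (H →L[ℂ] H)) (C : ℝ)
    (hnorm : ∀ v, ‖phiPoly T v‖ ≤ C * ‖trigPoly H v‖) (l : ℤ) (x : H) :
    (phiPoly T).extendOfNorm (trigPoly H)
      ((fourier (-l) : C(AddCircle (2 * Real.pi), ℂ)) •
        (ContinuousMap.const (AddCircle (2 * Real.pi)) x)) = T l x := by
  have h1 := LinearMap.extendOfNorm_eq trigPoly_dense ⟨C, hnorm⟩ (Finsupp.single l x)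
  rw [trigPoly_single, phiPoly_single] at h1
  exact h1


theorem norm_phi_extend_le (T : ℤ → (H →L[ℂ] H)) (C : ℝ) (hC : 0 ≤ C)
    (hnorm : ∀ v, ‖phiPoly T v‖ ≤ C * ‖trigPoly H v‖) :
    ‖(phiPoly T).extendOfNorm (trigPoly H)‖ ≤ C :=
  LinearMap.opNorm_extendOfNorm_le (f := phiPoly T) (e := trigPoly H) trigPoly_dense hC hnorm
theorem isPhiBound_intro (T : ℤ → (H →L[ℂ] H)) (C : ℝ) (Φ : C(AddCircle (2 * Real.pi), H) →L[ℂ] H)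
  (h1 : ∀ (l : ℤ) (x : H),
      Φ ((fourier (-l) : C(AddCircle (2 * Real.pi), ℂ)) •
        (ContinuousMap.const (AddCircle (2 * Real.pi)) x)) = T l x) (h2 : ‖Φ‖ ≤ C) : IsPhiBound T C :=
  ⟨Φ, h1, h2⟩
theorem isPhiBound_of_poly (T : ℤ → (H →L[ℂ] H)) (C : ℝ)  (hC : 0 ≤ C)
    (hnorm : ∀ v, ‖phiPoly T v‖ ≤ C * ‖trigPoly H v‖) : IsPhiBound T C :=
  isPhiBound_intro T C ((phiPoly T).extendOfNorm (trigPoly H)) (phiPoly_extend T C hnorm) (norm_phi_extend_le T C hC hnorm)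
theorem phi_of_mult (T : ℤ → (H →L[ℂ] H)) (C : ℝ) (hC : 0 ≤ C) (h : IsLeftToepMultBound T C) : IsPhiBound T C :=
  isPhiBound_of_poly T C hC (phiPoly_norm T C hC h)

/-- a Toeplitz matrix `A = (T_{j−k})` maps bounded Toeplitz matrices to
bounded matrices under left Schur multiplication iff `Φ_A` extends to a bounded operator
`C(𝕋, H) → H`; moreover the corresponding norms coincide. -/
theorem toeplitz_multiplier_iff_phi (T : ℤ → (H →L[ℂ] H)) :
    ((∃ C : ℝ, 0 ≤ C ∧ IsLeftToepMultBound T C) ↔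
      (∃ C : ℝ, 0 ≤ C ∧ IsPhiBound T C)) ∧
    sInf {C : ℝ | 0 ≤ C ∧ IsLeftToepMultBound T C} =
      sInf {C : ℝ | 0 ≤ C ∧ IsPhiBound T C} := by
  have key : ∀ C : ℝ, (0 ≤ C ∧ IsLeftToepMultBound T C) ↔ (0 ≤ C ∧ IsPhiBound T C) := fun C =>
    ⟨fun h => ⟨h.1, phi_of_mult T C h.1 h.2⟩, fun h => ⟨h.1, mult_of_phi T C h.1 h.2⟩⟩
  simp only [key, and_self]
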